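/- Let N ≥ 2 be an integer, γ > −N, ν ∈ (0,2), and let f : ℝ^N → [0,∞) be measurable satisfying the macroscopic bounds with constants M₁, M₀, E₀, H₀. Then there exist constants μ > 0, λ > 0 and C > 0, depending only on N, γ, ν, M₀, M₁, E₀ and H₀, such that for every v ∈ ℝ^N there is a measurable set A = A(v) ⊆ S^{N−1} with: (i) A = −A and surface measure |A| ≥ μ/(1+|v|); (ii) K̄_f(v,v') ≥ λ (1+|v|)^{1+γ+ν} |v−v'|^{−N−ν} whenever v' ≠ v and (v'−v)/|v'−v| ∈ A; (iii) |σ·v| ≤ C for every σ ∈ A. -/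

import Mathlib

open MeasureTheory Metric Set
open scoped ENNReal RealInnerProductSpace

noncomputable section

/-- The Boltzmann kernel
`K̄_f(v,v') = |v'-v|^{-N-ν} ∫_{w ⊥ (v'-v)} f(v+w) |w|^{γ+ν+1} dS(w)`,
where the inner integral is over the hyperplane orthogonal to `v' - v` with respect to the
`(N-1)`-dimensional Hausdorff measure. -/
def Kbar (N : ℕ) (γ ν : ℝ) (f : EuclideanSpace ℝ (Fin N) → ℝ)
    (v v' : EuclideanSpace ℝ (Fin N)) : ℝ≥0∞ :=
  ENNReal.ofReal (‖v' - v‖ ^ (-(N : ℝ) - ν)) *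
    ∫⁻ w in {w : EuclideanSpace ℝ (Fin N) | ⟪w, v' - v⟫ = 0},
      ENNReal.ofReal (f (v + w) * ‖w‖ ^ (γ + ν + 1)) ∂(μH[(N : ℝ) - 1])

/-- The entropy bound `∫ f log f ≤ H₀`, stated in the extended sense: the positive part of
the integral minus the negative part is at most `H₀` (the inequality is arranged in `ℝ≥0∞`
so that it is meaningful even when the integral is `-∞`). -/
def EntropyLE (N : ℕ) (f : EuclideanSpace ℝ (Fin N) → ℝ) (H₀ : ℝ) : Prop :=
  (∫⁻ v, ENNReal.ofReal (f v * Real.log (f v))) + ENNReal.ofReal (-H₀) ≤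
    (∫⁻ v, ENNReal.ofReal (-(f v * Real.log (f v)))) + ENNReal.ofReal H₀

/-- The macroscopic bounds for the Boltzmann equation: mass between `M₁` and `M₀`,
energy at most `E₀` and entropy at most `H₀`. -/
def MacroBounds (N : ℕ) (f : EuclideanSpace ℝ (Fin N) → ℝ) (M₁ M₀ E₀ H₀ : ℝ) : Prop :=
  ENNReal.ofReal M₁ ≤ (∫⁻ v, ENNReal.ofReal (f v)) ∧
  (∫⁻ v, ENNReal.ofReal (f v)) ≤ ENNReal.ofReal M₀ ∧
  (∫⁻ v, ENNReal.ofReal (‖v‖ ^ 2 * f v)) ≤ ENNReal.ofReal E₀ ∧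
  EntropyLE N f H₀

theorem neg_mul_log_le {a s : ℝ} (ha : 0 ≤ a) :
    -(a * Real.log a) ≤ s * a + Real.exp (-s) := by
  rcases ha.eq_or_lt with rfl | ha
  · simp [Real.exp_nonneg]
  have h := Real.log_le_sub_one_of_pos (x := Real.exp (-s) / a) (by positivity)
  rw [Real.log_div (Real.exp_ne_zero _) ha.ne', Real.log_exp] at h
  have h2 := mul_le_mul_of_nonneg_left h ha.le
  have h3 : a * (Real.exp (-s) / a - 1) = Real.exp (-s) - a := by field_simp
  rw [h3] at h2
  nlinarith

theorem lintegral_exp_neg_norm_sq_lt_top (N : ℕ) :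
    ∫⁻ v : EuclideanSpace ℝ (Fin N), ENNReal.ofReal (Real.exp (-‖v‖ ^ 2)) < ⊤ := by
  have h := GaussianFourier.integrable_cexp_neg_mul_sq_norm_add
    (b := 1) (V := EuclideanSpace ℝ (Fin N)) (by simp) 0 0
  have h2 := h.norm.lintegral_lt_top
  convert h2 using 4 with v
  rw [Complex.norm_exp]
  congr 1
  simp [← Complex.ofReal_pow]

/-- The positive part of the entropy is controlled by the energy and entropy bounds. -/
theorem exists_lintegral_mul_log_le (N : ℕ) (E₀ H₀ : ℝ) :
    ∃ P : ℝ, 0 < P ∧ ∀ f : EuclideanSpace ℝ (Fin N) → ℝ, Measurable f → (∀ v, 0 ≤ f v) →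
      (∫⁻ v, ENNReal.ofReal (‖v‖ ^ 2 * f v)) ≤ ENNReal.ofReal E₀ → EntropyLE N f H₀ →
      ∫⁻ v, ENNReal.ofReal (f v * Real.log (f v)) ≤ ENNReal.ofReal P := by
  set I := ∫⁻ v : EuclideanSpace ℝ (Fin N), ENNReal.ofReal (Real.exp (-‖v‖ ^ 2)) with hI
  have hfin : ENNReal.ofReal E₀ + I + ENNReal.ofReal H₀ ≠ ⊤ := by
    simp [(lintegral_exp_neg_norm_sq_lt_top N).ne, hI]
  refine ⟨(ENNReal.ofReal E₀ + I + ENNReal.ofReal H₀).toReal + 1, by positivity, ?_⟩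
  intro f hf h0 hE hH
  have hneg : ∫⁻ v, ENNReal.ofReal (-(f v * Real.log (f v))) ≤ ENNReal.ofReal E₀ + I := by
    calc _ ≤ ∫⁻ v, (ENNReal.ofReal (‖v‖ ^ 2 * f v) + ENNReal.ofReal (Real.exp (-‖v‖ ^ 2))) := by
          refine lintegral_mono fun v => ?_
          rw [← ENNReal.ofReal_add (mul_nonneg (by positivity) (h0 v)) (Real.exp_nonneg _)]
          exact ENNReal.ofReal_le_ofReal (neg_mul_log_le (h0 v))
      _ = (∫⁻ v, ENNReal.ofReal (‖v‖ ^ 2 * f v)) + I := by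
          rw [lintegral_add_left (by fun_prop)]
      _ ≤ _ := by gcongr
  have h1 : ∫⁻ v, ENNReal.ofReal (f v * Real.log (f v)) ≤
      ENNReal.ofReal E₀ + I + ENNReal.ofReal H₀ := by
    refine le_trans le_self_add (hH.trans ?_)
    gcongr
  refine h1.trans ?_
  rw [← ENNReal.ofReal_toReal hfin]
  exact ENNReal.ofReal_le_ofReal (by simp)

/-- The macroscopic bounds force a quantified part of the mass to sit on a bounded set where the
density is bounded below. -/
theorem exists_volume_superlevel_ge (N : ℕ) {M₁ E₀ H₀ : ℝ} (M₀ : ℝ) (hM₁ : 0 < M₁)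
    (hE₀ : 0 < E₀) :
    ∃ r l m : ℝ, 1 ≤ r ∧ 0 < l ∧ 0 < m ∧ ∀ f : EuclideanSpace ℝ (Fin N) → ℝ,
      Measurable f → (∀ v, 0 ≤ f v) → MacroBounds N f M₁ M₀ E₀ H₀ →
      ENNReal.ofReal m ≤ volume {z : EuclideanSpace ℝ (Fin N) | ‖z‖ ≤ r ∧ l ≤ f z} := by
  obtain ⟨P, hP, hPf⟩ := exists_lintegral_mul_log_le N E₀ H₀
  set r : ℝ := 1 + 4 * E₀ / M₁ with hr
  have hr1 : 1 ≤ r := by rw [hr]; simp; positivity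
  have hrE : E₀ / r ^ 2 ≤ M₁ / 4 := by
    rw [div_le_iff₀ (by positivity)]
    have : M₁ / 4 * r = M₁ / 4 + E₀ := by rw [hr]; field_simp
    nlinarith
  set B := volume (closedBall (0 : EuclideanSpace ℝ (Fin N)) r) with hB
  have hBfin : B ≠ ⊤ := measure_closedBall_lt_top.ne
  set l : ℝ := M₁ / (4 * (B.toReal + 1)) with hl
  have hl0 : 0 < l := by positivity
  have hlB : ENNReal.ofReal l * B ≤ ENNReal.ofReal (M₁ / 4) := by
    rw [← ENNReal.ofReal_toReal hBfin, ← ENNReal.ofReal_mul hl0.le]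
    apply ENNReal.ofReal_le_ofReal
    rw [hl, div_mul_eq_mul_div, div_le_div_iff₀ (by positivity) (by positivity)]
    nlinarith [B.toReal_nonneg]
  set q : ℝ := 4 * P / M₁ with hq
  have hq0 : 0 < q := by positivity
  set L : ℝ := Real.exp q with hL
  have hL0 : 0 < L := Real.exp_pos _
  refine ⟨r, l, M₁ / (4 * L), hr1, hl0, by positivity, ?_⟩
  rintro f hf h0 ⟨hm, -, hE, hH⟩
  have hPf := hPf f hf h0 hE hH
  set S := {z : EuclideanSpace ℝ (Fin N) | ‖z‖ ≤ r ∧ l ≤ f z} with hS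
  have hSm : MeasurableSet S :=
    (measurableSet_le measurable_norm measurable_const).inter
      (measurableSet_le measurable_const hf)
  have hpt : ∀ v, ENNReal.ofReal (f v) ≤ ENNReal.ofReal (1 / r ^ 2) * ENNReal.ofReal (‖v‖ ^ 2 * f v)
      + (closedBall 0 r).indicator (fun _ => ENNReal.ofReal l) v
      + ENNReal.ofReal (1 / q) * ENNReal.ofReal (f v * Real.log (f v))
      + S.indicator (fun _ => ENNReal.ofReal L) v := by
    intro v
    by_cases h1 : ‖v‖ ≤ r
    · by_cases h2 : l ≤ f v
      · by_cases h3 : f v ≤ L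
        · refine le_trans ?_ le_add_self
          rw [indicator_of_mem (show v ∈ S from ⟨h1, h2⟩)]
          exact ENNReal.ofReal_le_ofReal h3
        · refine le_trans (le_trans ?_ le_add_self) le_self_add
          rw [← ENNReal.ofReal_mul (by positivity)]
          apply ENNReal.ofReal_le_ofReal
          push Not at h3
          have : q ≤ Real.log (f v) := by
            rw [Real.le_log_iff_exp_le (hL0.trans h3)]; exact h3.le
          rw [one_div, ← div_eq_inv_mul, le_div_iff₀ hq0]
          exact mul_le_mul_of_nonneg_left this (h0 v)
      · refine le_trans (le_trans (le_trans ?_ le_add_self) le_self_add) le_self_add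
        rw [indicator_of_mem (by simpa using h1)]
        exact ENNReal.ofReal_le_ofReal (not_le.1 h2).le
    · refine le_trans (le_trans (le_trans ?_ le_self_add) le_self_add) le_self_add
      rw [← ENNReal.ofReal_mul (by positivity)]
      apply ENNReal.ofReal_le_ofReal
      push Not at h1
      rw [one_div, ← mul_assoc, ← div_eq_inv_mul]
      have : 1 ≤ ‖v‖ ^ 2 / r ^ 2 := by
        rw [one_le_div (by positivity)]; gcongr
      nlinarith [h0 v]
  have hint := lintegral_mono (μ := volume) hpt
  rw [lintegral_add_right _ (measurable_const.indicator hSm),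
    lintegral_add_right _ (by fun_prop),
    lintegral_add_right _ (measurable_const.indicator measurableSet_closedBall),
    lintegral_const_mul _ (by fun_prop), lintegral_const_mul _ (by fun_prop),
    lintegral_indicator_const hSm, lintegral_indicator_const measurableSet_closedBall] at hint
  have hc1 : ENNReal.ofReal (1 / r ^ 2) * (∫⁻ v, ENNReal.ofReal (‖v‖ ^ 2 * f v)) ≤
      ENNReal.ofReal (M₁ / 4) := by
    refine (mul_le_mul_right hE _).trans ?_
    rw [← ENNReal.ofReal_mul (by positivity)]
    apply ENNReal.ofReal_le_ofReal
    rw [one_div_mul_eq_div]; exact hrE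
  have hc3 : ENNReal.ofReal (1 / q) * (∫⁻ v, ENNReal.ofReal (f v * Real.log (f v))) ≤
      ENNReal.ofReal (M₁ / 4) := by
    refine (mul_le_mul_right hPf _).trans ?_
    rw [← ENNReal.ofReal_mul (by positivity)]
    apply ENNReal.ofReal_le_ofReal
    rw [hq]; apply le_of_eq; field_simp
  have htot := hm.trans (hint.trans (add_le_add (add_le_add (add_le_add hc1 hlB) hc3) le_rfl))
  by_cases htop : volume S = ⊤
  · rw [htop]; exact le_top
  rw [← ENNReal.ofReal_toReal htop] at htot ⊢
  rw [← ENNReal.ofReal_mul hL0.le, ← ENNReal.ofReal_add (by positivity) (by positivity),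
    ← ENNReal.ofReal_add (by positivity) (by positivity),
    ← ENNReal.ofReal_add (by positivity) (by positivity),
    ENNReal.ofReal_le_ofReal_iff (by positivity)] at htot
  apply ENNReal.ofReal_le_ofReal
  rw [div_le_iff₀ (by positivity)]
  nlinarith

/-- Averaging, over slopes in a fixed box, the volumes of the hyperplane slices of a set `T` on
which `p.2 j` is the dominant coordinate. -/
theorem volume_le_lintegral_slice {m : ℕ} (j : Fin (m + 1))
    {T : Set (ℝ × (Fin (m + 1) → ℝ))} (hT : MeasurableSet T) {R : ℝ}
    (hbd : ∀ p ∈ T, |p.1| ≤ |p.2 j| ∧ (∀ k, |p.2 k| ≤ |p.2 j|) ∧ p.2 j ≠ 0 ∧ |p.2 j| ≤ R)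
    {x : Fin m → ℝ} (hx : ∀ k, |x k| ≤ 1 / (m + 1)) :
    volume T ≤ ENNReal.ofReal R * ∫⁻ s in Icc (-2 : ℝ) 2,
      volume {y : Fin (m + 1) → ℝ | (-∑ k, (j.insertNth s x : Fin (m + 1) → ℝ) k * y k, y) ∈ T} := by
  have hsum : ∀ (s : ℝ) (y : Fin (m + 1) → ℝ),
      ∑ k, (j.insertNth s x : Fin (m + 1) → ℝ) k * y k
        = s * y j + ∑ k, x k * y (j.succAbove k) := by
    intro s y
    rw [Fin.sum_univ_succAbove _ j]
    simp
  simp only [hsum]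
  have hU : MeasurableSet {p : ℝ × (Fin (m + 1) → ℝ) |
      (-(p.1 * p.2 j + ∑ k, x k * p.2 (j.succAbove k)), p.2) ∈ T} := by
    refine hT.preimage ?_
    fun_prop
  have hsw : ∫⁻ s in Icc (-2 : ℝ) 2, volume {y : Fin (m + 1) → ℝ |
        (-(s * y j + ∑ k, x k * y (j.succAbove k)), y) ∈ T}
      = ∫⁻ y : Fin (m + 1) → ℝ, (volume.restrict (Icc (-2 : ℝ) 2)) {s : ℝ |
        (-(s * y j + ∑ k, x k * y (j.succAbove k)), y) ∈ T} :=
    (Measure.prod_apply (μ := volume.restrict (Icc (-2 : ℝ) 2)) (ν := volume) hU).symm.trans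
      (Measure.prod_apply_symm hU)
  have hm : Measurable fun y : Fin (m + 1) → ℝ => (volume.restrict (Icc (-2 : ℝ) 2)) {s : ℝ |
        (-(s * y j + ∑ k, x k * y (j.succAbove k)), y) ∈ T} :=
    measurable_measure_prodMk_right hU
  rw [hsw, ← lintegral_const_mul _ hm, Measure.volume_eq_prod, Measure.prod_apply_symm hT]
  refine lintegral_mono fun y => ?_
  rcases ((fun t => (t, y)) ⁻¹' T).eq_empty_or_nonempty with he | ⟨t₀, ht₀⟩
  · simp only [he, measure_empty, zero_le]
  obtain ⟨-, hk, hj, hR⟩ := hbd _ ht₀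
  dsimp only at hk hj hR
  set b := ∑ k, x k * y (j.succAbove k) with hb
  have hbb : |b| ≤ |y j| := by
    calc |b| ≤ ∑ k, |x k * y (j.succAbove k)| := Finset.abs_sum_le_sum_abs _ _
      _ ≤ ∑ k : Fin m, 1 / ((m : ℝ) + 1) * |y j| := by
          refine Finset.sum_le_sum fun k _ => ?_
          rw [abs_mul]
          exact mul_le_mul (hx k) (hk _) (abs_nonneg _) (by positivity)
      _ = (m / (m + 1)) * |y j| := by simp; ring
      _ ≤ 1 * |y j| := by
          gcongr
          rw [div_le_one (by positivity)]; linarith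
      _ = _ := one_mul _
  have hsub : {s : ℝ | (-(s * y j + b), y) ∈ T} ⊆ Icc (-2) 2 := by
    intro s hs
    have h1 : |s * y j + b| ≤ |y j| := by
      have := (hbd _ hs).1
      rwa [abs_neg] at this
    have h2 : |s * y j| ≤ 2 * |y j| := by
      calc |s * y j| = |(s * y j + b) - b| := by ring_nf
        _ ≤ |s * y j + b| + |b| := abs_sub _ _
        _ ≤ _ := by linarith
    rw [abs_mul] at h2
    exact abs_le.1 (le_of_mul_le_mul_right h2 (abs_pos.2 hj))
  rw [Measure.restrict_eq_self _ hsub]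
  have hpre : {s : ℝ | (-(s * y j + b), y) ∈ T} =
      (fun s => (-y j) * s) ⁻¹' ((fun t => t + (-b)) ⁻¹' ((fun t => (t, y)) ⁻¹' T)) := by
    ext s
    simp only [mem_ofPred_eq, mem_preimage]
    rw [show -(s * y j + b) = -y j * s + -b by ring]
  rw [hpre, Real.volume_preimage_mul_left (neg_ne_zero.2 hj), measure_preimage_add_right,
    ← mul_assoc, ← ENNReal.ofReal_mul ((abs_nonneg _).trans hR)]
  refine le_mul_of_one_le_left zero_le ?_
  rw [ENNReal.one_le_ofReal, abs_inv, abs_neg, ← div_eq_mul_inv, one_le_div (abs_pos.2 hj)]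
  exact hR

/-- A function supported on a set of measure at most `B` and bounded by `G` exceeds a level `t` on
a set whose measure is controlled from below by its integral. -/
theorem lintegral_le_mul_measure_superlevel {α : Type*} [MeasurableSpace α] (μ : Measure α)
    {g : α → ℝ≥0∞} (hg : Measurable g) {G B t : ℝ≥0∞} (hG : ∀ s, g s ≤ G)
    (hB : μ {s | g s ≠ 0} ≤ B) :
    ∫⁻ s, g s ∂μ ≤ G * μ {s | t ≤ g s} + t * B := by
  have h1 : MeasurableSet {s | t ≤ g s} := measurableSet_le measurable_const hg
  have h2 : MeasurableSet {s | g s ≠ 0} := (hg (measurableSet_singleton 0)).compl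
  calc ∫⁻ s, g s ∂μ ≤ ∫⁻ s, ({s | t ≤ g s}.indicator (fun _ => G) s
        + {s | g s ≠ 0}.indicator (fun _ => t) s) ∂μ := by
        refine lintegral_mono fun s => ?_
        by_cases h : t ≤ g s
        · rw [indicator_of_mem (show s ∈ {s | t ≤ g s} from h)]
          exact (hG s).trans le_self_add
        · by_cases h0 : g s = 0
          · simp [h0]
          · rw [indicator_of_mem (show s ∈ {s | g s ≠ 0} from h0)]
            exact (not_le.1 h).le.trans le_add_self
    _ = G * μ {s | t ≤ g s} + t * μ {s | g s ≠ 0} := by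
        rw [lintegral_add_left (measurable_const.indicator h1), lintegral_indicator_const h1,
          lintegral_indicator_const h2]
    _ ≤ _ := by gcongr

theorem measurePreserving_toLp_insertNth {n : ℕ} (i : Fin (n + 1)) :
    MeasurePreserving (fun p : ℝ × (Fin n → ℝ) =>
      (WithLp.toLp 2 (i.insertNth p.1 p.2 : Fin (n + 1) → ℝ) : EuclideanSpace ℝ (Fin (n + 1)))) :=
  (PiLp.volume_preserving_toLp (Fin (n + 1))).comp
    (volume_preserving_piFinSuccAbove (fun _ : Fin (n + 1) => ℝ) i).symm

/-- The Hausdorff measure of a hyperplane section dominates the volume of its coordinate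
projection. -/
theorem volume_le_hausdorffMeasure_hyperplane {n : ℕ} (i : Fin (n + 1))
    (W : Set (EuclideanSpace ℝ (Fin (n + 1)))) (x : Fin n → ℝ) :
    volume {y : Fin n → ℝ | WithLp.toLp 2 (i.insertNth (-∑ k, x k * y k) y) ∈ W} ≤
      μH[(n : ℝ)] {w | w ∈ W ∧ w i + ∑ k, x k * w (i.succAbove k) = 0} := by
  have hL : LipschitzWith 1
      (fun (w : EuclideanSpace ℝ (Fin (n + 1))) (k : Fin n) => w (i.succAbove k)) := by
    refine LipschitzWith.of_dist_le_mul fun w w' => ?_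
    rw [NNReal.coe_one, one_mul, dist_pi_le_iff dist_nonneg]
    intro k
    rw [dist_eq_norm, dist_eq_norm]
    exact PiLp.norm_apply_le (w - w') (i.succAbove k)
  have h := hL.hausdorffMeasure_image_le (d := n) (by positivity)
    {w | w ∈ W ∧ w i + ∑ k, x k * w (i.succAbove k) = 0}
  rw [ENNReal.coe_one, ENNReal.one_rpow, one_mul] at h
  refine le_trans ?_ h
  have hv := hausdorffMeasure_pi_real (ι := Fin n)
  rw [Fintype.card_fin] at hv
  rw [hv]
  refine measure_mono fun y hy => ⟨_, ⟨hy, ?_⟩, ?_⟩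
  · simp
  · ext k; simp

/-- The part of the unit sphere over the set `X` of slopes in the gnomonic chart centred at the
`i`-th coordinate axis. -/
def sphereOver {n : ℕ} (i : Fin (n + 1)) (X : Set (Fin n → ℝ)) :
    Set (EuclideanSpace ℝ (Fin (n + 1))) :=
  {σ | σ ∈ sphere (0 : EuclideanSpace ℝ (Fin (n + 1))) 1 ∧ 1 / (1 + 4 * (n : ℝ)) ≤ σ i ∧
    (fun k => σ (i.succAbove k) / σ i) ∈ X}

theorem measurableSet_sphereOver {n : ℕ} (i : Fin (n + 1)) {X : Set (Fin n → ℝ)}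
    (hX : MeasurableSet X) : MeasurableSet (sphereOver i X) := by
  refine isClosed_sphere.measurableSet.inter (MeasurableSet.inter ?_ ?_)
  · exact measurableSet_le measurable_const
      (show Measurable fun σ : EuclideanSpace ℝ (Fin (n + 1)) => σ i by fun_prop)
  · refine hX.preimage (measurable_pi_lambda _ fun k => ?_)
    fun_prop

theorem volume_le_hausdorffMeasure_sphereOver {n : ℕ} (i : Fin (n + 1)) {X : Set (Fin n → ℝ)}
    (hX : ∀ x ∈ X, ∀ k, |x k| ≤ 2) :
    volume X ≤ ENNReal.ofReal ((2 * (1 + 4 * (n : ℝ)) ^ 2) ^ n) *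
      μH[(n : ℝ)] (sphereOver i X) := by
  have hL : LipschitzOnWith (2 * (1 + 4 * (n : NNReal)) ^ 2)
      (fun (w : EuclideanSpace ℝ (Fin (n + 1))) (k : Fin n) => w (i.succAbove k) / w i)
      (sphereOver i X) := by
    refine LipschitzOnWith.of_dist_le_mul fun w hw w' hw' => ?_
    rw [dist_pi_le_iff (by positivity)]
    intro k
    obtain ⟨hw1, hwi, -⟩ := hw
    obtain ⟨hw1', hwi', -⟩ := hw'
    have hp : 0 < 1 / (1 + 4 * (n : ℝ)) := by positivity
    have hi : 0 < w i := hp.trans_le hwi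
    have hi' : 0 < w' i := hp.trans_le hwi'
    have hd : ∀ l, |w l - w' l| ≤ dist w w' := fun l => by
      rw [dist_eq_norm]; exact PiLp.norm_apply_le (w - w') l
    have hn : ∀ l, |w l| ≤ 1 := fun l => by
      have := PiLp.norm_apply_le w l
      rwa [mem_sphere_zero_iff_norm.1 hw1] at this
    have hinv : ∀ {a : ℝ}, 1 / (1 + 4 * (n : ℝ)) ≤ a → 1 / a ≤ 1 + 4 * (n : ℝ) := fun {a} ha => by
      rw [div_le_comm₀ (by positivity) (hp.trans_le ha)] at ha
      exact ha
    rw [Real.dist_eq]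
    have e : w (i.succAbove k) / w i - w' (i.succAbove k) / w' i =
        (w i * (w (i.succAbove k) - w' (i.succAbove k)) - w (i.succAbove k) * (w i - w' i))
          * ((1 / w i) * (1 / w' i)) := by
      field_simp; ring
    rw [e, abs_mul, abs_of_pos (a := (1 / w i) * (1 / w' i)) (by positivity)]
    have h1 : |w i * (w (i.succAbove k) - w' (i.succAbove k)) - w (i.succAbove k) * (w i - w' i)|
        ≤ 2 * dist w w' := by
      refine (abs_sub _ _).trans ?_
      rw [abs_mul, abs_mul]
      have a1 := mul_le_mul (hn i) (hd (i.succAbove k)) (abs_nonneg _) zero_le_one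
      have a2 := mul_le_mul (hn (i.succAbove k)) (hd i) (abs_nonneg _) zero_le_one
      linarith
    have h2 : (1 / w i) * (1 / w' i) ≤ (1 + 4 * (n : ℝ)) ^ 2 := by
      rw [sq]
      exact mul_le_mul (hinv hwi) (hinv hwi') (by positivity) (by positivity)
    calc _ ≤ (2 * dist w w') * (1 + 4 * (n : ℝ)) ^ 2 :=
          mul_le_mul h1 h2 (by positivity) (by positivity)
      _ = _ := by push_cast; ring
  have h := hL.hausdorffMeasure_image_le (d := n) (by positivity)
  have hv := hausdorffMeasure_pi_real (ι := Fin n)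
  rw [Fintype.card_fin] at hv
  rw [hv] at h
  have hc : ENNReal.ofReal ((2 * (1 + 4 * (n : ℝ)) ^ 2) ^ n) =
      ((2 * (1 + 4 * (n : NNReal)) ^ 2 : NNReal) : ℝ≥0∞) ^ (n : ℝ) := by
    rw [ENNReal.rpow_natCast, ENNReal.ofReal_pow (by positivity)]
    congr 1
    rw [← ENNReal.ofReal_coe_nnreal]
    push_cast
    rfl
  rw [hc]
  refine le_trans (measure_mono fun x hx => ?_) h
  set u : EuclideanSpace ℝ (Fin (n + 1)) := WithLp.toLp 2 (i.insertNth 1 x) with hu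
  have hui : u i = 1 := by simp [hu]
  have huk : ∀ k, u (i.succAbove k) = x k := fun k => by simp [hu]
  have hnorm : ‖u‖ ^ 2 = 1 + ∑ k, x k ^ 2 := by
    rw [EuclideanSpace.real_norm_sq_eq, Fin.sum_univ_succAbove _ i]
    simp [hui, huk]
  have hle : ∑ k, x k ^ 2 ≤ 4 * (n : ℝ) := by
    calc _ ≤ ∑ _k : Fin n, (4 : ℝ) := Finset.sum_le_sum fun k _ => by
          have := hX x hx k
          rw [← sq_abs]
          nlinarith [abs_nonneg (x k)]
      _ = _ := by simp; ring
  have hge : 0 ≤ ∑ k, x k ^ 2 := Finset.sum_nonneg fun k _ => sq_nonneg _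
  have hu0 : 0 < ‖u‖ := norm_pos_iff.2 fun h0 => by simp [h0] at hui
  have hu1 : ‖u‖ ≤ 1 + 4 * (n : ℝ) := by
    refine le_of_sq_le_sq ?_ (by positivity)
    nlinarith
  have hq : (fun k => (‖u‖⁻¹ • u) (i.succAbove k) / (‖u‖⁻¹ • u) i) = x := by
    ext k
    simp only [PiLp.smul_apply, smul_eq_mul, hui, huk]
    field_simp
  refine ⟨‖u‖⁻¹ • u, ⟨?_, ?_, ?_⟩, hq⟩
  · rw [mem_sphere_zero_iff_norm, norm_smul, norm_inv, norm_norm, inv_mul_cancel₀ hu0.ne']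
  · simp only [PiLp.smul_apply, smul_eq_mul, hui, mul_one]
    rw [one_div]
    exact inv_anti₀ hu0 hu1
  · rw [hq]; exact hx

theorem norm_le_card_mul_of_abs_le {N : ℕ} {w : EuclideanSpace ℝ (Fin N)} {c : ℝ} (hc : 0 ≤ c)
    (h : ∀ k, |w k| ≤ c) : ‖w‖ ≤ N * c := by
  have h1 : ‖w‖ ^ 2 ≤ N * c ^ 2 := by
    rw [EuclideanSpace.real_norm_sq_eq]
    calc _ ≤ ∑ _k : Fin N, c ^ 2 := Finset.sum_le_sum fun k _ => by
          rw [← sq_abs]; gcongr; exact h k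
      _ = _ := by simp
  refine le_of_sq_le_sq (h1.trans ?_) (by positivity)
  rw [mul_pow]
  have : (N : ℝ) ≤ (N : ℝ) ^ 2 := by exact_mod_cast Nat.le_self_pow (by norm_num) N
  gcongr

theorem sum_mul_box_le {m : ℕ} {x z : Fin m → ℝ} {r : ℝ} (hr : 0 ≤ r)
    (hx : ∀ k, |x k| ≤ 1 / (m + 1)) (hz : ∀ k, |z k| ≤ r) : |∑ k, x k * z k| ≤ r := by
  calc |∑ k, x k * z k| ≤ ∑ k, |x k * z k| := Finset.abs_sum_le_sum_abs _ _
    _ ≤ ∑ k : Fin m, 1 / ((m : ℝ) + 1) * r := by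
        refine Finset.sum_le_sum fun k _ => ?_
        rw [abs_mul]
        exact mul_le_mul (hx k) (hz _) (abs_nonneg _) (by positivity)
    _ = (m / (m + 1)) * r := by simp; ring
    _ ≤ 1 * r := by
        gcongr
        rw [div_le_one (by positivity)]; linarith
    _ = _ := one_mul _

/-- The slopes `s` for which a hyperplane through `v` can meet the ball of radius `r` form a band of
width of order `1 / (1 + ‖v‖)`. -/
theorem volume_band_le {m : ℕ} {r : ℝ} (hr : 1 ≤ r) (v : EuclideanSpace ℝ (Fin (m + 2)))
    (i : Fin (m + 2)) (j : Fin (m + 1)) {x : Fin m → ℝ} (hx : ∀ k, |x k| ≤ 1 / (m + 1)) :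
    volume.restrict (Icc (-2 : ℝ) 2) {s | ∃ w : EuclideanSpace ℝ (Fin (m + 2)), ‖v + w‖ ≤ r ∧
        (∀ k, |w k| ≤ |w (i.succAbove j)|) ∧
        w i + s * w (i.succAbove j) + ∑ k, x k * w (i.succAbove (j.succAbove k)) = 0} ≤
      ENNReal.ofReal ((8 + 48 * (m + 2) * r) / (1 + ‖v‖)) := by
  have hv0 := norm_nonneg v
  have hN : (2 : ℝ) ≤ m + 2 := by linarith [m.cast_nonneg (α := ℝ)]
  have hr0 : 0 < r := by linarith
  have hNr : 2 ≤ ((m : ℝ) + 2) * r := by nlinarith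
  by_cases hv : ‖v‖ ≤ 4 * (m + 2) * r + 1
  · calc _ ≤ volume.restrict (Icc (-2 : ℝ) 2) univ := measure_mono (subset_univ _)
      _ = ENNReal.ofReal 4 := by
          rw [Measure.restrict_apply_univ, Real.volume_Icc]; norm_num
      _ ≤ _ := by
          apply ENNReal.ofReal_le_ofReal
          rw [le_div_iff₀ (by positivity)]
          nlinarith
  push Not at hv
  set S := {s : ℝ | ∃ w : EuclideanSpace ℝ (Fin (m + 2)), ‖v + w‖ ≤ r ∧
        (∀ k, |w k| ≤ |w (i.succAbove j)|) ∧
        w i + s * w (i.succAbove j) + ∑ k, x k * w (i.succAbove (j.succAbove k)) = 0} with hS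
  have hcoord : ∀ {w : EuclideanSpace ℝ (Fin (m + 2))}, ‖v + w‖ ≤ r → ∀ k, |v k + w k| ≤ r :=
    fun {w} h k => (PiLp.norm_apply_le (v + w) k).trans h
  set a := v (i.succAbove j) with ha
  rcases S.eq_empty_or_nonempty with he | ⟨s₀, w₀, hw1, hw2, -⟩
  · rw [he, measure_empty]; exact zero_le
  have hva : (1 + ‖v‖) / (4 * (m + 2)) ≤ |a| := by
    have h1 := norm_le_card_mul_of_abs_le (abs_nonneg _) hw2
    have h2 : ‖v‖ ≤ r + ‖w₀‖ := by
      calc ‖v‖ = ‖(v + w₀) - w₀‖ := by simp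
        _ ≤ ‖v + w₀‖ + ‖w₀‖ := norm_sub_le _ _
        _ ≤ _ := by gcongr
    have h3 : |w₀ (i.succAbove j)| ≤ r + |a| := by
      calc |w₀ (i.succAbove j)| = |(a + w₀ (i.succAbove j)) - a| := by simp
        _ ≤ |a + w₀ (i.succAbove j)| + |a| := abs_sub _ _
        _ ≤ _ := by gcongr; exact hcoord hw1 _
    rw [div_le_iff₀ (by positivity)]
    push_cast at h1
    have h4 : ((m : ℝ) + 2) * |w₀ (i.succAbove j)| ≤ (m + 2) * (r + |a|) := by gcongr
    nlinarith
  have ha0 : 0 < |a| := lt_of_lt_of_le (by positivity) hva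
  set b := v i + ∑ k, x k * v (i.succAbove (j.succAbove k)) with hb
  have hsub : S ∩ Icc (-2 : ℝ) 2 ⊆ closedBall (-b / a) (4 * r / |a|) := by
    rintro s ⟨⟨w, h1, -, h3⟩, hs⟩
    have hc := hcoord h1
    have e : s * a + b = (v i + w i) + s * (v (i.succAbove j) + w (i.succAbove j)) +
        ∑ k, x k * (v (i.succAbove (j.succAbove k)) + w (i.succAbove (j.succAbove k))) := by
      simp only [mul_add, Finset.sum_add_distrib, hb, ← ha]
      linear_combination -h3
    have h5 : |s * a + b| ≤ 4 * r := by
      rw [e]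
      have t1 := hc i
      have t2 : |s * (v (i.succAbove j) + w (i.succAbove j))| ≤ 2 * r := by
        rw [abs_mul]
        exact mul_le_mul (abs_le.2 hs) (hc _) (abs_nonneg _) (by norm_num)
      have t3 := sum_mul_box_le hr0.le hx (fun k => hc (i.succAbove (j.succAbove k)))
      refine (abs_add_three _ _ _).trans ?_
      linarith
    rw [mem_closedBall, Real.dist_eq, le_div_iff₀ ha0, ← abs_mul]
    have : (s - -b / a) * a = s * a + b := by
      have := abs_pos.1 ha0
      field_simp; ring
    rwa [this]
  rw [Measure.restrict_apply' measurableSet_Icc]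
  refine (measure_mono hsub).trans ?_
  rw [Real.volume_closedBall]
  apply ENNReal.ofReal_le_ofReal
  rw [le_div_iff₀ (by positivity), mul_comm, mul_div_assoc', mul_div_assoc', div_le_iff₀ ha0]
  rw [div_le_iff₀ (by positivity)] at hva
  nlinarith [mul_le_mul_of_nonneg_left hva hr0.le, abs_nonneg a]

/-- The volume of the projected hyperplane section of `W` with slope `x`. -/
def sliceVolume {n : ℕ} (i : Fin (n + 1)) (W : Set (EuclideanSpace ℝ (Fin (n + 1))))
    (x : Fin n → ℝ) : ℝ≥0∞ :=
  volume {y : Fin n → ℝ | WithLp.toLp 2 (i.insertNth (-∑ k, x k * y k) y) ∈ W}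

theorem measurable_sliceVolume {n : ℕ} (i : Fin (n + 1))
    {W : Set (EuclideanSpace ℝ (Fin (n + 1)))} (hW : MeasurableSet W) :
    Measurable (sliceVolume i W) := by
  have h : Measurable fun p : (Fin n → ℝ) × (Fin n → ℝ) => ((-∑ k, p.1 k * p.2 k, p.2) :
      ℝ × (Fin n → ℝ)) := by fun_prop
  exact measurable_measure_prodMk_left
    (hW.preimage ((measurePreserving_toLp_insertNth i).measurable.comp h))

theorem sliceVolume_le {n : ℕ} (i : Fin (n + 1)) {W : Set (EuclideanSpace ℝ (Fin (n + 1)))}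
    {r : ℝ} (hr : 0 ≤ r) (v : EuclideanSpace ℝ (Fin (n + 1))) (hW : ∀ w ∈ W, ‖v + w‖ ≤ r)
    (x : Fin n → ℝ) : sliceVolume i W x ≤ ENNReal.ofReal ((2 * r) ^ n) := by
  have h : {y : Fin n → ℝ | WithLp.toLp 2 (i.insertNth (-∑ k, x k * y k) y) ∈ W} ⊆
      closedBall (fun k => -v (i.succAbove k)) r := by
    intro y hy
    rw [mem_closedBall, dist_pi_le_iff hr]
    intro k
    have := (PiLp.norm_apply_le _ (i.succAbove k)).trans (hW _ hy)
    rw [Real.dist_eq, sub_neg_eq_add, add_comm]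
    simpa using this
  refine (measure_mono h).trans ?_
  rw [Real.volume_pi_closedBall _ hr, Fintype.card_fin]

/-- If every point of `W` has a dominant `j`-th projected coordinate, then for every `x` in a small
box the slopes `s` whose hyperplane section of `W` is large form a set of measure of order
`1 / (1 + ‖v‖)`. -/
theorem exists_volume_slope_ge (m : ℕ) {r m₀ : ℝ} (hr : 1 ≤ r) (hm₀ : 0 < m₀) :
    ∃ t c : ℝ, 0 < t ∧ 0 < c ∧ ∀ (v : EuclideanSpace ℝ (Fin (m + 2))) (i : Fin (m + 2))
      (j : Fin (m + 1)) (W : Set (EuclideanSpace ℝ (Fin (m + 2)))), MeasurableSet W →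
      (∀ w ∈ W, ‖v + w‖ ≤ r ∧ w ≠ 0 ∧ ∀ k, |w k| ≤ |w (i.succAbove j)|) →
      ENNReal.ofReal m₀ ≤ volume W → ∀ x : Fin m → ℝ, (∀ k, |x k| ≤ 1 / (m + 1)) →
      ENNReal.ofReal (c / (1 + ‖v‖)) ≤ volume.restrict (Icc (-2 : ℝ) 2)
        {s | ENNReal.ofReal t ≤ sliceVolume i W (j.insertNth s x)} := by
  have hr0 : 0 < r := by linarith
  set c₁ : ℝ := 1 + r with hc₁
  set c₂ : ℝ := 8 + 48 * (m + 2) * r with hc₂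
  set G : ℝ := (2 * r) ^ (m + 1) with hG
  have h1 : 0 < c₁ := by positivity
  have h2 : 0 < c₂ := by positivity
  have h3 : 0 < G := by positivity
  refine ⟨m₀ / (2 * c₁ * c₂), m₀ / (2 * c₁ * G), by positivity, by positivity, ?_⟩
  intro v i j W hW hWp hvol x hx
  have hv0 := norm_nonneg v
  have hg : Measurable fun s : ℝ => sliceVolume i W (j.insertNth s x) := by
    refine (measurable_sliceVolume i hW).comp ?_
    exact (MeasurableEquiv.piFinSuccAbove (fun _ : Fin (m + 1) => ℝ) j).symm.measurable.comp
      measurable_prodMk_right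
  have hmp := measurePreserving_toLp_insertNth i
  have hT := volume_le_lintegral_slice j (hW.preimage hmp.measurable) (R := c₁ * (1 + ‖v‖)) ?_ hx
  · rw [hmp.measure_preimage hW.nullMeasurableSet] at hT
    have hS := lintegral_le_mul_measure_superlevel (volume.restrict (Icc (-2 : ℝ) 2)) hg
      (t := ENNReal.ofReal (m₀ / (2 * c₁ * c₂)))
      (fun s => sliceVolume_le i hr0.le v (fun w hw => (hWp w hw).1) _)
      (B := ENNReal.ofReal (c₂ / (1 + ‖v‖))) ?_
    · have hfin := hvol.trans (hT.trans (mul_le_mul_right hS _))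
      set X := volume.restrict (Icc (-2 : ℝ) 2)
        {s | ENNReal.ofReal (m₀ / (2 * c₁ * c₂)) ≤ sliceVolume i W (j.insertNth s x)} with hX
      have hXtop : X ≠ ⊤ := measure_ne_top _ _
      rw [← ENNReal.ofReal_toReal hXtop] at hfin ⊢
      rw [← ENNReal.ofReal_mul (by positivity), ← ENNReal.ofReal_mul (by positivity),
        ← ENNReal.ofReal_add (by positivity) (by positivity), ← ENNReal.ofReal_mul (by positivity),
        ENNReal.ofReal_le_ofReal_iff (by positivity)] at hfin
      apply ENNReal.ofReal_le_ofReal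
      have e : c₁ * (1 + ‖v‖) * (G * X.toReal + m₀ / (2 * c₁ * c₂) * (c₂ / (1 + ‖v‖))) =
          c₁ * (1 + ‖v‖) * (G * X.toReal) + m₀ / 2 := by
        field_simp
      rw [← hG, e] at hfin
      rw [div_div, div_le_iff₀ (by positivity)]
      nlinarith
    · refine (measure_mono fun s hs => ?_).trans (volume_band_le hr v i j hx)
      obtain ⟨y, hy⟩ := nonempty_of_measure_ne_zero hs
      refine ⟨_, (hWp _ hy).1, (hWp _ hy).2.2, ?_⟩
      have : ∑ k, (j.insertNth s x : Fin (m + 1) → ℝ) k * y k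
          = s * y j + ∑ k, x k * y (j.succAbove k) := by
        rw [Fin.sum_univ_succAbove _ j]
        simp
      simp only [Fin.insertNth_apply_same, Fin.insertNth_apply_succAbove, this]
      ring
  · rintro p hp
    obtain ⟨q1, q2, q3⟩ := hWp _ hp
    set w : EuclideanSpace ℝ (Fin (m + 2)) := WithLp.toLp 2 (i.insertNth p.1 p.2) with hw
    have e1 : w i = p.1 := by simp [hw]
    have e2 : ∀ k, w (i.succAbove k) = p.2 k := fun k => by simp [hw]
    rw [e2] at q3
    refine ⟨e1 ▸ q3 i, fun k => e2 k ▸ q3 _, fun h0 => q2 ?_, ?_⟩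
    · ext k
      have := q3 k
      rw [h0, abs_zero] at this
      simpa using abs_nonpos_iff.1 this
    · rw [← e2 j]
      refine (PiLp.norm_apply_le w _).trans ?_
      calc ‖w‖ = ‖(v + w) - v‖ := by simp
        _ ≤ ‖v + w‖ + ‖v‖ := norm_sub_le _ _
        _ ≤ _ := by nlinarith

/-- The slopes with a large hyperplane section of `W` fill a set of measure of order
`1 / (1 + ‖v‖)` in the gnomonic chart. -/
theorem exists_volume_slopes_ge (m : ℕ) {r m₀ : ℝ} (hr : 1 ≤ r) (hm₀ : 0 < m₀) :
    ∃ t c : ℝ, 0 < t ∧ 0 < c ∧ ∀ (v : EuclideanSpace ℝ (Fin (m + 2))) (i : Fin (m + 2))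
      (j : Fin (m + 1)) (W : Set (EuclideanSpace ℝ (Fin (m + 2)))), MeasurableSet W →
      (∀ w ∈ W, ‖v + w‖ ≤ r ∧ w ≠ 0 ∧ ∀ k, |w k| ≤ |w (i.succAbove j)|) →
      ENNReal.ofReal m₀ ≤ volume W →
      ENNReal.ofReal (c / (1 + ‖v‖)) ≤
        volume {x | (∀ k, |x k| ≤ 2) ∧ ENNReal.ofReal t ≤ sliceVolume i W x} := by
  obtain ⟨t, c, ht, hc, H⟩ := exists_volume_slope_ge m hr hm₀
  refine ⟨t, (1 / (m + 1)) ^ m * c, ht, by positivity, ?_⟩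
  intro v i j W hW hWp hvol
  have H := H v i j W hW hWp hvol
  set X := {x : Fin (m + 1) → ℝ | (∀ k, |x k| ≤ 2) ∧ ENNReal.ofReal t ≤ sliceVolume i W x}
    with hX
  have hXm : MeasurableSet X := by
    refine MeasurableSet.inter ?_ (measurableSet_le measurable_const (measurable_sliceVolume i hW))
    have : {x : Fin (m + 1) → ℝ | ∀ k, |x k| ≤ 2} = ⋂ k, {x | |x k| ≤ 2} := by
      ext; simp
    refine (this ▸ MeasurableSet.iInter fun k => ?_ :
      MeasurableSet {x : Fin (m + 1) → ℝ | ∀ k, |x k| ≤ 2})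
    exact measurableSet_le (measurable_pi_apply k).abs measurable_const
  have hmp := (volume_preserving_piFinSuccAbove (fun _ : Fin (m + 1) => ℝ) j).symm
  rw [← hmp.measure_preimage hXm.nullMeasurableSet, Measure.volume_eq_prod,
    Measure.prod_apply_symm (hXm.preimage hmp.measurable)]
  set Q : Set (Fin m → ℝ) := Icc 0 (fun _ => 1 / ((m : ℝ) + 1)) with hQ
  have hQv : volume Q = ENNReal.ofReal ((1 / (m + 1)) ^ m) := by
    rw [hQ, Real.volume_Icc_pi, ENNReal.ofReal_pow (by positivity)]
    simp
  calc ENNReal.ofReal ((1 / (m + 1)) ^ m * c / (1 + ‖v‖))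
      = ∫⁻ _x in Q, ENNReal.ofReal (c / (1 + ‖v‖)) := by
        rw [setLIntegral_const, hQv, ← ENNReal.ofReal_mul (by positivity)]
        congr 1; ring
    _ ≤ ∫⁻ x in Q, volume ((fun s => (s, x)) ⁻¹'
          ((MeasurableEquiv.piFinSuccAbove (fun _ : Fin (m + 1) => ℝ) j).symm ⁻¹' X)) := by
        refine setLIntegral_mono' measurableSet_Icc fun x hx => ?_
        have hm1 : 1 / ((m : ℝ) + 1) ≤ 2 := by
          rw [div_le_iff₀ (by positivity)]; linarith [m.cast_nonneg (α := ℝ)]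
        have hxb : ∀ k, |x k| ≤ 1 / ((m : ℝ) + 1) := fun k => by
          rw [abs_of_nonneg (hx.1 k)]; exact hx.2 k
        refine (H x hxb).trans ?_
        rw [Measure.restrict_apply' measurableSet_Icc]
        refine measure_mono ?_
        rintro s ⟨hs, hs2⟩
        refine ⟨fun k => ?_, hs⟩
        show |(j.insertNth s x : Fin (m + 1) → ℝ) k| ≤ 2
        refine Fin.succAboveCases j ?_ (fun l => ?_) k
        · simpa using abs_le.2 hs2
        · simpa using (hxb l).trans hm1
    _ ≤ _ := setLIntegral_le_lintegral _ _

theorem exists_mul_rpow_le_norm_rpow {E : Type*} [NormedAddCommGroup E] {r δ : ℝ} (hr : 1 ≤ r)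
    (hδ : 0 < δ) (p : ℝ) :
    ∃ c : ℝ, 0 < c ∧ ∀ v w : E, ‖v + w‖ ≤ r → δ ≤ ‖w‖ → c * (1 + ‖v‖) ^ p ≤ ‖w‖ ^ p := by
  set a : ℝ := min (δ / (1 + 2 * r)) (1 / 4) with ha
  have ha0 : 0 < a := by rw [ha]; positivity
  have hlow : ∀ v w : E, ‖v + w‖ ≤ r → δ ≤ ‖w‖ → a * (1 + ‖v‖) ≤ ‖w‖ := by
    intro v w h1 h2
    have hv0 := norm_nonneg v
    by_cases hv : ‖v‖ ≤ 2 * r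
    · calc a * (1 + ‖v‖) ≤ δ / (1 + 2 * r) * (1 + 2 * r) := by
            gcongr; exact min_le_left _ _
        _ = δ := by field_simp
        _ ≤ _ := h2
    · push Not at hv
      have h3 : ‖v‖ ≤ r + ‖w‖ := by
        calc ‖v‖ = ‖(v + w) - w‖ := by simp
          _ ≤ ‖v + w‖ + ‖w‖ := norm_sub_le _ _
          _ ≤ _ := by gcongr
      have : a * (1 + ‖v‖) ≤ 1 / 4 * (1 + ‖v‖) := by gcongr; exact min_le_right _ _
      linarith
  have hup : ∀ v w : E, ‖v + w‖ ≤ r → ‖w‖ ≤ (1 + r) * (1 + ‖v‖) := by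
    intro v w h1
    have hv0 := norm_nonneg v
    calc ‖w‖ = ‖(v + w) - v‖ := by simp
      _ ≤ ‖v + w‖ + ‖v‖ := norm_sub_le _ _
      _ ≤ _ := by nlinarith
  rcases le_total 0 p with hp | hp
  · refine ⟨a ^ p, Real.rpow_pos_of_pos ha0 p, fun v w h1 h2 => ?_⟩
    rw [← Real.mul_rpow ha0.le (by positivity)]
    exact Real.rpow_le_rpow (by positivity) (hlow v w h1 h2) hp
  · refine ⟨(1 + r) ^ p, by positivity, fun v w h1 h2 => ?_⟩
    rw [← Real.mul_rpow (by positivity) (by positivity)]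
    exact Real.rpow_le_rpow_of_nonpos (hδ.trans_le h2) (hup v w h1) hp

theorem exists_volume_ball_le (N : ℕ) [NeZero N] {m : ℝ} (hm : 0 < m) :
    ∃ δ : ℝ, 0 < δ ∧ volume (ball (0 : EuclideanSpace ℝ (Fin N)) δ) ≤ ENNReal.ofReal m := by
  set B := volume (ball (0 : EuclideanSpace ℝ (Fin N)) 1) with hB
  have hBt : B ≠ ⊤ := measure_ball_lt_top.ne
  have hB0 := B.toReal_nonneg
  have hδ : 0 < min 1 (m / (B.toReal + 1)) := by positivity
  refine ⟨min 1 (m / (B.toReal + 1)), hδ, ?_⟩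
  have hBe : B = ENNReal.ofReal B.toReal := (ENNReal.ofReal_toReal hBt).symm
  rw [Measure.addHaar_ball _ _ hδ.le, ← hB, finrank_euclideanSpace, Fintype.card_fin]
  refine (congrArg _ hBe).trans_le ?_
  rw [← ENNReal.ofReal_mul (by positivity)]
  apply ENNReal.ofReal_le_ofReal
  calc min 1 (m / (B.toReal + 1)) ^ N * B.toReal
      ≤ min 1 (m / (B.toReal + 1)) * B.toReal := by
        gcongr
        exact pow_le_of_le_one hδ.le (min_le_left _ _) (NeZero.ne N)
    _ ≤ m / (B.toReal + 1) * B.toReal := by gcongr; exact min_le_right _ _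
    _ ≤ m := by
        rw [div_mul_eq_mul_div, div_le_iff₀ (by positivity)]; nlinarith

/-- Some coordinate is dominant on a proportional part of a set. -/
theorem exists_volume_dominant_ge {N : ℕ} [NeZero N] (W : Set (EuclideanSpace ℝ (Fin N))) {a : ℝ}
    (hW : ENNReal.ofReal a ≤ volume W) :
    ∃ j : Fin N, ENNReal.ofReal (a / N) ≤ volume {w | w ∈ W ∧ ∀ k, |w k| ≤ |w j|} := by
  by_contra! h
  have hN : (0 : ℝ) < N := by exact_mod_cast Nat.pos_of_ne_zero (NeZero.ne N)
  have hsub : W ⊆ ⋃ j : Fin N, {w | w ∈ W ∧ ∀ k, |w k| ≤ |w j|} := by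
    intro w hw
    obtain ⟨j, hj⟩ := Finite.exists_max fun k => |w k|
    exact mem_iUnion.2 ⟨j, hw, hj⟩
  have h1 := hW.trans ((measure_mono hsub).trans (measure_iUnion_fintype_le volume _))
  have h2 : ∑ j : Fin N, volume {w | w ∈ W ∧ ∀ k, |w k| ≤ |w j|} <
      ∑ _j : Fin N, ENNReal.ofReal (a / N) :=
    ENNReal.sum_lt_sum_of_nonempty Finset.univ_nonempty fun j _ => h j
  rw [Finset.sum_const, Finset.card_univ, Fintype.card_fin, nsmul_eq_mul,
    ← ENNReal.ofReal_natCast, ← ENNReal.ofReal_mul hN.le, mul_div_cancel₀ _ hN.ne'] at h2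
  exact absurd h1 (not_le.2 h2)

theorem inner_eq_mul_slope {n : ℕ} (i : Fin (n + 1)) (w σ : EuclideanSpace ℝ (Fin (n + 1)))
    (hσ : σ i ≠ 0) :
    ⟪w, σ⟫ = σ i * (w i + ∑ k, σ (i.succAbove k) / σ i * w (i.succAbove k)) := by
  rw [PiLp.inner_apply, Fin.sum_univ_succAbove _ i, mul_add, Finset.mul_sum]
  simp only [RCLike.inner_apply, conj_trivial]
  congr 1
  refine Finset.sum_congr rfl fun k _ => ?_
  field_simp

theorem slope_pos {n : ℕ} {i : Fin (n + 1)} {X : Set (Fin n → ℝ)}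
    {σ : EuclideanSpace ℝ (Fin (n + 1))} (h : σ ∈ sphereOver i X) : 0 < σ i :=
  lt_of_lt_of_le (show 0 < 1 / (1 + 4 * (n : ℝ)) by positivity) h.2.1

/-- Directions over slopes with a nontrivial section of `W` are almost orthogonal to `v`. -/
theorem abs_inner_le_of_mem_sphereOver {n : ℕ} {i : Fin (n + 1)}
    {W : Set (EuclideanSpace ℝ (Fin (n + 1)))} {X : Set (Fin n → ℝ)} {r : ℝ}
    {v σ : EuclideanSpace ℝ (Fin (n + 1))} (hW : ∀ w ∈ W, ‖v + w‖ ≤ r)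
    (hX : ∀ x ∈ X, sliceVolume i W x ≠ 0) (hσ : σ ∈ sphereOver i X) : |⟪σ, v⟫| ≤ r := by
  obtain ⟨y, hy⟩ := nonempty_of_measure_ne_zero (hX _ hσ.2.2)
  set w : EuclideanSpace ℝ (Fin (n + 1)) := WithLp.toLp 2
    (i.insertNth (-∑ k, σ (i.succAbove k) / σ i * y k) y) with hw
  have hz : ⟪σ, w⟫ = 0 := by
    rw [real_inner_comm, inner_eq_mul_slope i w σ (slope_pos hσ).ne']
    simp [hw]
  calc |⟪σ, v⟫| = |⟪σ, v + w⟫| := by rw [inner_add_right, hz, add_zero]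
    _ ≤ ‖σ‖ * ‖v + w‖ := abs_real_inner_le_norm _ _
    _ ≤ 1 * r := by
        rw [mem_sphere_zero_iff_norm.1 hσ.1]
        gcongr
        exact hW w hy
    _ = r := one_mul r

/-- The kernel is bounded below in directions whose orthogonal hyperplane has a large section. -/
theorem le_Kbar_of_le_sliceVolume {n : ℕ} {γ ν b t : ℝ} (hb : 0 ≤ b)
    {f : EuclideanSpace ℝ (Fin (n + 1)) → ℝ} {i : Fin (n + 1)}
    {W : Set (EuclideanSpace ℝ (Fin (n + 1)))} (hWm : MeasurableSet W)
    {v v' τ : EuclideanSpace ℝ (Fin (n + 1))}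
    (hW : ∀ w ∈ W, b ≤ f (v + w) * ‖w‖ ^ (γ + ν + 1)) (hτ : τ i ≠ 0) {q : ℝ}
    (hd : v' - v = q • τ)
    (hs : ENNReal.ofReal t ≤ sliceVolume i W fun k => τ (i.succAbove k) / τ i) :
    ENNReal.ofReal (b * t * ‖v - v'‖ ^ (-((n + 1 : ℕ) : ℝ) - ν)) ≤ Kbar (n + 1) γ ν f v v' := by
  have hdim : ((n + 1 : ℕ) : ℝ) - 1 = n := by push_cast; ring
  set H := {w : EuclideanSpace ℝ (Fin (n + 1)) | ⟪w, v' - v⟫ = 0} with hH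
  have hHm : MeasurableSet H :=
    (isClosed_eq (continuous_id.inner continuous_const) continuous_const).measurableSet
  set V := {w | w ∈ W ∧ w i + ∑ k, τ (i.succAbove k) / τ i * w (i.succAbove k) = 0} with hV
  have hVm : MeasurableSet V := hWm.inter
    (measurableSet_eq_fun (by fun_prop) measurable_const)
  have hVH : V ⊆ H := by
    rintro w ⟨-, hw⟩
    rw [hH, mem_ofPred_eq, hd, inner_smul_right, inner_eq_mul_slope i w τ hτ, hw, mul_zero,
      mul_zero]
  have hVt : ENNReal.ofReal t ≤ μH[(n : ℝ)] V :=
    hs.trans (volume_le_hausdorffMeasure_hyperplane i W _)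
  rw [Kbar, hdim, norm_sub_rev v v', mul_comm (b * t), ENNReal.ofReal_mul (by positivity),
    ENNReal.ofReal_mul hb]
  gcongr
  calc ENNReal.ofReal b * ENNReal.ofReal t ≤ ENNReal.ofReal b * μH[(n : ℝ)] V := by gcongr
    _ = ∫⁻ _w in V, ENNReal.ofReal b ∂μH[(n : ℝ)] := (setLIntegral_const _ _).symm
    _ ≤ ∫⁻ w in V, ENNReal.ofReal (f (v + w) * ‖w‖ ^ (γ + ν + 1)) ∂μH[(n : ℝ)] :=
        setLIntegral_mono' hVm fun w hw => ENNReal.ofReal_le_ofReal (hW w hw.1)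
    _ ≤ _ := lintegral_mono_set hVH

/-- **Refined cone lower bound for the Boltzmann kernel, valid for all velocities**
(Lemma 7.1 of the paper). If `f` satisfies the macroscopic bounds, then for every
`v ∈ ℝ^N` there is a symmetric subset `A` of the unit sphere of measure at least
`μ/(1+|v|)`, contained in a band of width `C/|v|` around the great circle perpendicular to
`v`, such that `K̄_f(v,v') ≥ λ (1+|v|)^{1+γ+ν} |v-v'|^{-N-ν}` whenever
`(v'-v)/|v'-v| ∈ A`. -/
theorem kernel_cone_lower_bound_large_velocities
    (N : ℕ) (hN : 2 ≤ N) (γ ν M₁ M₀ E₀ H₀ : ℝ)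
    (hγ : -(N : ℝ) < γ) (hν : ν ∈ Ioo (0:ℝ) 2)
    (hM₁ : 0 < M₁) (hM : M₁ ≤ M₀) (hE₀ : 0 < E₀) :
    ∃ mu lam C : ℝ, 0 < mu ∧ 0 < lam ∧ 0 < C ∧
      ∀ f : EuclideanSpace ℝ (Fin N) → ℝ,
        Measurable f → (∀ v, 0 ≤ f v) →
        MacroBounds N f M₁ M₀ E₀ H₀ →
        ∀ v : EuclideanSpace ℝ (Fin N),
          ∃ A : Set (EuclideanSpace ℝ (Fin N)),
            A ⊆ sphere (0 : EuclideanSpace ℝ (Fin N)) 1 ∧ MeasurableSet A ∧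
            -- (i) A is symmetric and has measure at least μ/(1+|v|)
            A = -A ∧
            ENNReal.ofReal (mu / (1 + ‖v‖)) ≤ μH[(N : ℝ) - 1] A ∧
            -- (ii) lower bound on the kernel in the directions of A
            (∀ v' : EuclideanSpace ℝ (Fin N), v' ≠ v → ‖v' - v‖⁻¹ • (v' - v) ∈ A →
              ENNReal.ofReal (lam * (1 + ‖v‖) ^ (1 + γ + ν) * ‖v - v'‖ ^ (-(N : ℝ) - ν)) ≤
                Kbar N γ ν f v v') ∧
            -- (iii) A is contained in a band around the great circle perpendicular to v
            (∀ σ ∈ A, |⟪σ, v⟫| ≤ C) := by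
  obtain ⟨m, rfl⟩ : ∃ m, N = m + 2 := ⟨N - 2, by omega⟩
  obtain ⟨r, l, m₀, hr, hl, hm₀, hS⟩ :=
    exists_volume_superlevel_ge (m + 2) (H₀ := H₀) M₀ hM₁ hE₀
  obtain ⟨δ, hδ, hδB⟩ := exists_volume_ball_le (m + 2) (half_pos hm₀)
  obtain ⟨a, ha, hweight⟩ := exists_mul_rpow_le_norm_rpow
    (E := EuclideanSpace ℝ (Fin (m + 2))) hr hδ (γ + ν + 1)
  obtain ⟨t, c, ht, hc, hslopes⟩ := exists_volume_slopes_ge m hr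
    (show 0 < m₀ / 2 / ((m + 2 : ℕ) : ℝ) by positivity)
  set D : ℝ := (2 * (1 + 4 * ((m + 1 : ℕ) : ℝ)) ^ 2) ^ (m + 1) with hD
  have hD0 : 0 < D := by positivity
  refine ⟨c / D, l * a * t, r, by positivity, by positivity, by linarith, ?_⟩
  intro f hf h0 hmac v
  have hS := hS f hf h0 hmac
  have hSm : MeasurableSet {z : EuclideanSpace ℝ (Fin (m + 2)) | ‖z‖ ≤ r ∧ l ≤ f z} :=
    (measurableSet_le measurable_norm measurable_const).inter
      (measurableSet_le measurable_const hf)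
  set W₀ : Set (EuclideanSpace ℝ (Fin (m + 2))) :=
    ((fun w => v + w) ⁻¹' {z | ‖z‖ ≤ r ∧ l ≤ f z}) \ ball 0 δ with hW₀
  have hW₀m : MeasurableSet W₀ :=
    (hSm.preimage (measurable_const_add v)).diff measurableSet_ball
  have hW₀v : ENNReal.ofReal (m₀ / 2) ≤ volume W₀ := by
    refine le_trans ?_ (le_measure_sdiff (μ := volume) (s₁ := (fun w => v + w) ⁻¹' _))
    rw [measure_preimage_add]
    calc ENNReal.ofReal (m₀ / 2) = ENNReal.ofReal m₀ - ENNReal.ofReal (m₀ / 2) := by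
          rw [← ENNReal.ofReal_sub _ (by positivity)]; congr 1; ring
      _ ≤ _ := tsub_le_tsub hS hδB
  obtain ⟨j₀, hj₀⟩ := exists_volume_dominant_ge W₀ hW₀v
  obtain ⟨i, hi⟩ := exists_ne j₀
  obtain ⟨j, rfl⟩ := Fin.exists_succAbove_eq hi.symm
  set W := {w | w ∈ W₀ ∧ ∀ k, |w k| ≤ |w (i.succAbove j)|} with hW
  have hWm : MeasurableSet W := by
    have : W = W₀ ∩ ⋂ k, {w | |w k| ≤ |w (i.succAbove j)|} := by ext; simp [hW]
    rw [this]
    refine hW₀m.inter (MeasurableSet.iInter fun k => measurableSet_le ?_ ?_)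
    · exact Measurable.abs (by fun_prop)
    · exact Measurable.abs (by fun_prop)
  have hWδ : ∀ w ∈ W, δ ≤ ‖w‖ := fun w hw => by simpa using hw.1.2
  have hWr : ∀ w ∈ W, ‖v + w‖ ≤ r := fun w hw => hw.1.1.1
  have hvol := hslopes v i j W hWm
    (fun w hw => ⟨hWr w hw, norm_pos_iff.1 (hδ.trans_le (hWδ w hw)), hw.2⟩) hj₀
  set X := {x : Fin (m + 1) → ℝ | (∀ k, |x k| ≤ 2) ∧ ENNReal.ofReal t ≤ sliceVolume i W x}
    with hX
  have hXm : MeasurableSet X := by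
    have : X = (⋂ k, {x | |x k| ≤ 2}) ∩ {x | ENNReal.ofReal t ≤ sliceVolume i W x} := by
      ext; simp [hX]
    rw [this]
    exact (MeasurableSet.iInter fun k =>
      measurableSet_le (measurable_pi_apply k).abs measurable_const).inter
      (measurableSet_le measurable_const (measurable_sliceVolume i hWm))
  have hA := measurableSet_sphereOver i hXm
  have hdim : ((m + 2 : ℕ) : ℝ) - 1 = (m + 1 : ℕ) := by push_cast; ring
  refine ⟨sphereOver i X ∪ -sphereOver i X, ?_, hA.union hA.neg, ?_, ?_, ?_, ?_⟩
  · rintro σ (hσ | hσ)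
    · exact hσ.1
    · simpa using hσ.1
  · rw [union_neg, neg_neg, union_comm]
  · rw [hdim]
    refine le_trans ?_ (measure_mono subset_union_left)
    have h := hvol.trans (volume_le_hausdorffMeasure_sphereOver i (X := X) fun x hx => hx.1)
    rw [← hD, mul_comm] at h
    rw [div_right_comm, ENNReal.ofReal_div_of_pos hD0]
    exact ENNReal.div_le_of_le_mul h
  · intro v' hv' hσ
    have hd0 : ‖v' - v‖ ≠ 0 := norm_ne_zero_iff.2 (sub_ne_zero.2 hv')
    have hb : ∀ w ∈ W, l * (a * (1 + ‖v‖) ^ (γ + ν + 1)) ≤ f (v + w) * ‖w‖ ^ (γ + ν + 1) :=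
      fun w hw => mul_le_mul hw.1.1.2 (hweight v w (hWr w hw) (hWδ w hw)) (by positivity) (h0 _)
    have key : ∀ τ ∈ sphereOver i X, ∀ q : ℝ, v' - v = q • τ →
        ENNReal.ofReal (l * a * t * (1 + ‖v‖) ^ (1 + γ + ν) *
          ‖v - v'‖ ^ (-((m + 2 : ℕ) : ℝ) - ν)) ≤ Kbar (m + 2) γ ν f v v' := by
      intro τ hτ q hq
      have h := le_Kbar_of_le_sliceVolume (by positivity) hWm hb (slope_pos hτ).ne' hq hτ.2.2.2
      rw [show γ + ν + 1 = 1 + γ + ν by ring] at h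
      convert h using 3
      ring
    rcases hσ with hσ | hσ
    · exact key _ hσ ‖v' - v‖ (by rw [smul_smul, mul_inv_cancel₀ hd0, one_smul])
    · exact key _ hσ (-‖v' - v‖) (by
        rw [smul_neg, neg_smul, neg_neg, smul_smul, mul_inv_cancel₀ hd0, one_smul])
  · have hX0 : ∀ x ∈ X, sliceVolume i W x ≠ 0 := fun x hx =>
      ((ENNReal.ofReal_pos.2 ht).trans_le hx.2).ne'
    rintro σ (hσ | hσ)
    · exact abs_inner_le_of_mem_sphereOver hWr hX0 hσ
    · have := abs_inner_le_of_mem_sphereOver hWr hX0 hσ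
      rwa [inner_neg_left, abs_neg] at this
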